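/- Minimax rate for estimating a smooth signal on a large graph: let G_n be a sequence of connected graphs on n vertices with Laplacian L_n = D_n − A_n whose ordered eigenvalues 0 = λ_{n,0} ≤ λ_{n,1} ≤ … ≤ λ_{n,n−1} satisfy the geometry condition with dimension r ≥ 1, i.e. there exist i_0 and constants C_1, C_2 > 0 with C_1 (i/n)^{2/r} ≤ λ_{n,i} ≤ C_2 (i/n)^{2/r} for all i_0 ≤ i ≤ n − 1. Observe Y = f + ε with ε ~ N(0, I_n), and for β > 0, Q > 0 define the Hölder-type ball B^β(Q) = { f ∈ ℝ^n : n^{−1} ⟨f, (I + (n^{2/r} L_n)^β) f⟩ ≤ Q² }. Then there exist constants 0 < c ≤ C (depending on β, Q, r, C_1, C_2) such that for all n large enough, c · n^{−2β/(2β+r)} ≤ inf over measurable estimators f̂ : ℝ^n → ℝ^n of sup over f ∈ B^β(Q) of n^{−1} E_f ‖f̂(Y) − f‖² ≤ C · n^{−2β/(2β+r)}. -/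

import Mathlib

open MeasureTheory Filter Matrix
open scoped ENNReal

/-- The standard normal density. -/
noncomputable def gaussDensity (x : ℝ) : ℝ :=
  Real.exp (-(x ^ 2) / 2) / Real.sqrt (2 * Real.pi)

/-- The Hölder-type ball `B^β(Q) = {f : n⁻¹⟨f, (I + (n^{2/r}L)^β)f⟩ ≤ Q²}`, expressed
through an orthogonal eigendecomposition `L = U diag(μ) Uᵀ` of the graph Laplacian. -/
def holderBall (n : ℕ) (r β Q : ℝ) (U : Matrix (Fin n) (Fin n) ℝ)
    (ev : Fin n → ℝ) : Set (Fin n → ℝ) :=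
  {f | (1 / (n : ℝ)) * ∑ i, (1 + ((n : ℝ) ^ (2 / r) * ev i) ^ β) *
    (∑ k, U k i * f k) ^ 2 ≤ Q ^ 2}

/-- Normalized squared-error risk `n⁻¹ E_f ‖f̂(Y) − f‖²` in the model `Y ~ N(f, Iₙ)`. -/
noncomputable def graphRisk (n : ℕ) (est : (Fin n → ℝ) → Fin n → ℝ)
    (f : Fin n → ℝ) : ℝ≥0∞ :=
  ((n : ℝ≥0∞))⁻¹ *
    ∫⁻ y, ENNReal.ofReal ((∑ i, (est y i - f i) ^ 2) * ∏ i, gaussDensity (y i - f i))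

/-- The minimax normalized risk over the Hölder ball. -/
noncomputable def graphMinimax (n : ℕ) (r β Q : ℝ) (U : Matrix (Fin n) (Fin n) ℝ)
    (ev : Fin n → ℝ) : ℝ≥0∞ :=
  ⨅ (est : (Fin n → ℝ) → Fin n → ℝ) (_ : Measurable est),
    ⨆ f ∈ holderBall n r β Q U ev, graphRisk n est f

open ProbabilityTheory in
lemma gaussDensity_sub (x a : ℝ) : gaussDensity (x - a) = gaussianPDFReal a 1 x := by
  simp [gaussDensity, gaussianPDFReal, div_eq_inv_mul]

lemma gaussDensity_nonneg (x : ℝ) : 0 ≤ gaussDensity x := by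
  unfold gaussDensity; positivity

lemma measurable_gaussDensity : Measurable gaussDensity := by
  unfold gaussDensity; fun_prop

open ProbabilityTheory in
lemma pi_gaussianReal_eq_withDensity {ι : Type*} [Fintype ι] (f : ι → ℝ) :
    Measure.pi (fun i => gaussianReal (f i) 1) =
      (volume : Measure (ι → ℝ)).withDensity
        (fun y => ENNReal.ofReal (∏ i, gaussDensity (y i - f i))) := by
  refine Measure.pi_eq fun s hs => ?_
  have hint (i : ι) : Integrable (gaussianPDFReal (f i) 1) (volume.restrict (s i)) :=
    (integrable_gaussianPDFReal _ _).restrict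
  rw [withDensity_apply _ (MeasurableSet.univ_pi hs), volume_pi, Measure.restrict_pi_pi]
  simp_rw [gaussDensity_sub]
  rw [← ofReal_integral_eq_lintegral_ofReal (Integrable.fintype_prod hint)
      (.of_forall fun y => Finset.prod_nonneg fun i _ => gaussianPDFReal_nonneg _ _ _),
    integral_fintype_prod_eq_prod (fun i => gaussianPDFReal (f i) 1),
    ENNReal.ofReal_prod_of_nonneg
      fun i _ => integral_nonneg fun x => gaussianPDFReal_nonneg _ _ _]
  exact Finset.prod_congr rfl fun i _ =>
    (gaussianReal_apply_eq_integral _ one_ne_zero _).symm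

lemma lintegral_prod_gaussDensity {ι : Type*} [Fintype ι] (f : ι → ℝ) :
    ∫⁻ y : ι → ℝ, ENNReal.ofReal (∏ i, gaussDensity (y i - f i)) = 1 := by
  rw [← setLIntegral_univ, ← withDensity_apply _ MeasurableSet.univ,
    ← pi_gaussianReal_eq_withDensity, measure_univ]

lemma measurable_prod_gaussDensity {ι : Type*} [Fintype ι] (f : ι → ℝ) :
    Measurable fun y : ι → ℝ => ∏ i, gaussDensity (y i - f i) :=
  Finset.measurable_prod _ fun i _ =>
    measurable_gaussDensity.comp ((measurable_pi_apply i).sub_const _)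

open ProbabilityTheory in
lemma lintegral_sq_linear_mul_gaussDensity {ι : Type*} [Fintype ι] (f u : ι → ℝ)
    (hu : ∑ k, u k ^ 2 = 1) :
    ∫⁻ y : ι → ℝ, ENNReal.ofReal
      ((∑ k, u k * (y k - f k)) ^ 2 * ∏ i, gaussDensity (y i - f i)) = 1 := by
  have hmem (k : ι) : MemLp (fun x : ℝ => u k * (x - f k)) 2 (gaussianReal (f k) 1) :=
    ((memLp_id_gaussianReal 2).sub (memLp_const (f k))).const_mul (u k)
  have hmem' (k : ι) : MemLp (fun y : ι → ℝ => u k * (y k - f k)) 2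
      (Measure.pi fun i => gaussianReal (f i) 1) :=
    (hmem k).comp_measurePreserving (measurePreserving_eval _ k)
  have hsum : MemLp (fun y : ι → ℝ => ∑ k, u k * (y k - f k)) 2
      (Measure.pi fun i => gaussianReal (f i) 1) := memLp_finsetSum _ fun k _ => hmem' k
  have hmean : ∫ y : ι → ℝ, ∑ k, u k * (y k - f k)
      ∂(Measure.pi fun i => gaussianReal (f i) 1) = 0 := by
    rw [integral_finsetSum _ fun k _ => (hmem' k).integrable one_le_two]
    refine Finset.sum_eq_zero fun k _ => ?_
    rw [integral_comp_eval (μ := fun i => gaussianReal (f i) 1) (f := fun x => u k * (x - f k))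
      (hmem k).aestronglyMeasurable, integral_const_mul,
      integral_sub (f := fun x => x) ((memLp_id_gaussianReal 1).integrable le_rfl)
        (integrable_const _)]
    simp
  have hvar : Var[fun y : ι → ℝ => ∑ k, u k * (y k - f k);
      Measure.pi fun i => gaussianReal (f i) 1] = 1 := by
    have h := variance_sum_pi (μ := fun i => gaussianReal (f i) 1) hmem
    have e : (∑ i, fun (ω : ι → ℝ) => u i * (ω i - f i)) =
      fun y : ι → ℝ => ∑ k, u k * (y k - f k) := by ext; simp
    rw [e] at h
    rw [h, ← hu]
    refine Finset.sum_congr rfl fun k _ => ?_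
    rw [variance_const_mul, variance_sub_const (X := fun x => x)
      measurable_id.aestronglyMeasurable]
    simp
  rw [variance_of_integral_eq_zero hsum.aestronglyMeasurable.aemeasurable hmean] at hvar
  simp_rw [mul_comm (_ ^ 2) (∏ i, gaussDensity _)]
  simp_rw [ENNReal.ofReal_mul (Finset.prod_nonneg fun i _ => gaussDensity_nonneg _)]
  have h := lintegral_withDensity_eq_lintegral_mul volume
    (measurable_prod_gaussDensity f).ennreal_ofReal
    (g := fun y => ENNReal.ofReal ((∑ k, u k * (y k - f k)) ^ 2)) (by fun_prop)
  simp only [Pi.mul_apply] at h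
  rw [← h, ← pi_gaussianReal_eq_withDensity, ← ofReal_integral_eq_lintegral_ofReal hsum.integrable_sq
      (.of_forall fun y => sq_nonneg _), hvar, ENNReal.ofReal_one]

lemma sum_sq_transpose_mulVec {n : ℕ} {U : Matrix (Fin n) (Fin n) ℝ} (hU : Uᵀ * U = 1)
    (v : Fin n → ℝ) : ∑ j, (∑ k, U k j * v k) ^ 2 = ∑ i, v i ^ 2 := by
  have h : (Uᵀ *ᵥ v) ⬝ᵥ (Uᵀ *ᵥ v) = v ⬝ᵥ v := by
    rw [dotProduct_mulVec, vecMul_transpose, mulVec_mulVec, mul_eq_one_comm.mp hU, one_mulVec]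
  simpa [dotProduct, mulVec, sq] using h

lemma sum_mul_sum_of_transpose_mul_self {n : ℕ} {U : Matrix (Fin n) (Fin n) ℝ}
    (hU : Uᵀ * U = 1) (θ : Fin n → ℝ) (j : Fin n) :
    ∑ k, U k j * ∑ i, U k i * θ i = θ j := by
  have h : (Uᵀ *ᵥ (U *ᵥ θ)) j = θ j := by rw [mulVec_mulVec, hU, one_mulVec]
  simpa [dotProduct, mulVec] using h

lemma sum_sq_col {n : ℕ} {U : Matrix (Fin n) (Fin n) ℝ} (hU : Uᵀ * U = 1) (j : Fin n) :
    ∑ k, U k j ^ 2 = 1 := by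
  have h := congrFun (congrFun hU j) j
  simpa [mul_apply, sq] using h

/-- Upper bound on the minimax risk, from the projection onto the eigenvectors indexed by `F`. -/
lemma graphMinimax_le {n : ℕ} (hn : 0 < n) {r β Q B : ℝ} {U : Matrix (Fin n) (Fin n) ℝ}
    {ev : Fin n → ℝ} (hU : Uᵀ * U = 1) (hev : ∀ i, 0 ≤ ev i) (F : Finset (Fin n))
    (hB : 0 < B) (hF : ∀ j ∉ F, B ≤ 1 + ((n : ℝ) ^ (2 / r) * ev j) ^ β) :
    graphMinimax n r β Q U ev ≤ ENNReal.ofReal (F.card / n + Q ^ 2 / B) := by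
  have hn' : (0 : ℝ) < n := by exact_mod_cast hn
  have hest : Measurable fun (y : Fin n → ℝ) (i : Fin n) =>
      ∑ j, U i j * (if j ∈ F then ∑ k, U k j * y k else 0) := by
    refine measurable_pi_lambda _ fun i => Finset.measurable_sum _ fun j _ => ?_
    by_cases h : j ∈ F <;> simp only [h, if_true, if_false] <;> fun_prop
  refine iInf₂_le_of_le _ hest (iSup₂_le fun f hf => ?_)
  set θ : Fin n → ℝ := fun j => ∑ k, U k j * f k with hθ
  have hloss (y : Fin n → ℝ) :
      ∑ i, (∑ j, U i j * (if j ∈ F then ∑ k, U k j * y k else 0) - f i) ^ 2 =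
        ∑ j, (if j ∈ F then (∑ k, U k j * (y k - f k)) ^ 2 else θ j ^ 2) := by
    rw [← sum_sq_transpose_mulVec hU]
    refine Finset.sum_congr rfl fun j _ => ?_
    simp_rw [mul_sub, Finset.sum_sub_distrib]
    rw [sum_mul_sum_of_transpose_mul_self hU]
    split_ifs <;> simp [hθ]
  have hterm (j : Fin n) : ∫⁻ y : Fin n → ℝ, ENNReal.ofReal
      ((if j ∈ F then (∑ k, U k j * (y k - f k)) ^ 2 else θ j ^ 2) *
        ∏ i, gaussDensity (y i - f i)) = ENNReal.ofReal (if j ∈ F then 1 else θ j ^ 2) := by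
    split_ifs
    · rw [lintegral_sq_linear_mul_gaussDensity f (fun k => U k j) (sum_sq_col hU j),
        ENNReal.ofReal_one]
    · simp_rw [ENNReal.ofReal_mul (sq_nonneg (θ j))]
      rw [lintegral_const_mul _ (measurable_prod_gaussDensity f).ennreal_ofReal,
        lintegral_prod_gaussDensity, mul_one]
  have hnn (j : Fin n) : 0 ≤ if j ∈ F then (1 : ℝ) else θ j ^ 2 := by split_ifs <;> positivity
  have hrisk : ∫⁻ y : Fin n → ℝ, ENNReal.ofReal
      ((∑ i, (∑ j, U i j * (if j ∈ F then ∑ k, U k j * y k else 0) - f i) ^ 2) *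
        ∏ i, gaussDensity (y i - f i)) =
      ENNReal.ofReal (∑ j, if j ∈ F then 1 else θ j ^ 2) := by
    rw [ENNReal.ofReal_sum_of_nonneg fun j _ => hnn j]
    simp_rw [← hterm]
    rw [← lintegral_finsetSum]
    · refine lintegral_congr fun y => ?_
      rw [hloss, Finset.sum_mul, ENNReal.ofReal_sum_of_nonneg]
      intro j _
      refine mul_nonneg ?_ (Finset.prod_nonneg fun i _ => gaussDensity_nonneg _)
      split_ifs <;> positivity
    · intro j _
      have := measurable_prod_gaussDensity f
      split_ifs <;> fun_prop
  unfold graphRisk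
  rw [hrisk, ← ENNReal.ofReal_natCast, ← ENNReal.ofReal_inv_of_pos hn',
    ← ENNReal.ofReal_mul (by positivity)]
  refine ENNReal.ofReal_le_ofReal ?_
  have hpt (j : Fin n) : (if j ∈ F then (1 : ℝ) else θ j ^ 2) ≤
      (if j ∈ F then 1 else 0) + (1 + ((n : ℝ) ^ (2 / r) * ev j) ^ β) * θ j ^ 2 / B := by
    have hw : 0 ≤ ((n : ℝ) ^ (2 / r) * ev j) ^ β :=
      Real.rpow_nonneg (mul_nonneg (Real.rpow_nonneg hn'.le _) (hev j)) _
    split_ifs with h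
    · have : 0 ≤ (1 + ((n : ℝ) ^ (2 / r) * ev j) ^ β) * θ j ^ 2 / B := by positivity
      linarith
    · rw [zero_add, le_div_iff₀ hB, mul_comm]
      exact mul_le_mul_of_nonneg_right (hF j h) (sq_nonneg _)
  have hsum := Finset.sum_le_sum fun j (_ : j ∈ Finset.univ) => hpt j
  rw [Finset.sum_add_distrib, ← Finset.sum_div] at hsum
  have hf' : (1 / (n : ℝ)) * ∑ i, (1 + ((n : ℝ) ^ (2 / r) * ev i) ^ β) * θ i ^ 2 ≤ Q ^ 2 := hf
  have hcard : (∑ j, if j ∈ F then (1 : ℝ) else 0) = F.card := by simp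
  rw [hcard] at hsum
  calc (n : ℝ)⁻¹ * ∑ j, (if j ∈ F then (1 : ℝ) else θ j ^ 2)
      ≤ (n : ℝ)⁻¹ *
        (F.card + (∑ i, (1 + ((n : ℝ) ^ (2 / r) * ev i) ^ β) * θ i ^ 2) / B) := by gcongr
    _ = F.card / n +
        (1 / (n : ℝ) * ∑ i, (1 + ((n : ℝ) ^ (2 / r) * ev i) ^ β) * θ i ^ 2) / B := by
      field_simp
    _ ≤ F.card / n + Q ^ 2 / B := by gcongr

lemma two_point_pointwise {p q m e a t : ℝ} (hp : 0 ≤ p) (hq : 0 ≤ q) (he : 0 < e)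
    (h : p * q = m ^ 2 * e) :
    4 * a ^ 2 * e * m ≤
      (t - a) ^ 2 * p + (t + a) ^ 2 * q + a ^ 2 * e * p + a ^ 2 * e * q := by
  rcases (add_nonneg hp hq).eq_or_lt with h0 | hs
  · have hp0 : p = 0 := by linarith
    have hq0 : q = 0 := by linarith
    subst hp0 hq0
    have : m = 0 := by
      have : m ^ 2 * e = 0 := by linarith
      simpa [he.ne'] using this
    simp [this]
  · refine le_of_mul_le_mul_right ?_ hs
    have h1 : 0 ≤ (t * (p + q) - a * (p - q)) ^ 2 := sq_nonneg _
    have h2 : 0 ≤ a ^ 2 * e * (2 * m - (p + q)) ^ 2 := by positivity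
    have h3 : a ^ 2 * (p * q) = a ^ 2 * (m ^ 2 * e) := by rw [h]
    linarith

lemma prod_gaussDensity_mul {ι : Type*} [Fintype ι] {f g : ι → ℝ} {a : ℝ}
    (h : ∑ k, (f k - g k) ^ 2 = 4 * a ^ 2) (y : ι → ℝ) :
    (∏ i, gaussDensity (y i - f i)) * ∏ i, gaussDensity (y i - g i) =
      (∏ i, gaussDensity (y i - (f i + g i) / 2)) ^ 2 * Real.exp (-a ^ 2) := by
  have ha : -a ^ 2 = ∑ k, -((f k - g k) ^ 2 / 4) := by
    rw [Finset.sum_neg_distrib, ← Finset.sum_div, h]; ring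
  rw [ha, Real.exp_sum, ← Finset.prod_pow, ← Finset.prod_mul_distrib,
    ← Finset.prod_mul_distrib]
  refine Finset.prod_congr rfl fun i _ => ?_
  unfold gaussDensity
  rw [div_mul_div_comm, div_pow, ← Real.exp_add, ← Real.exp_nat_mul, div_mul_eq_mul_div,
    ← Real.exp_add, sq (Real.sqrt _)]
  congr 2
  push_cast
  ring

/-- Two-point lower bound for testing between the Gaussian means `f` and `g`. -/
lemma two_point_lower_bound {ι : Type*} [Fintype ι] {f g : ι → ℝ} {a : ℝ}
    (h : ∑ k, (f k - g k) ^ 2 = 4 * a ^ 2) {t : (ι → ℝ) → ℝ} (ht : Measurable t) :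
    ENNReal.ofReal (2 * (a ^ 2 * Real.exp (-a ^ 2))) ≤
      (∫⁻ y, ENNReal.ofReal ((t y - a) ^ 2 * ∏ i, gaussDensity (y i - f i))) +
      ∫⁻ y, ENNReal.ofReal ((t y + a) ^ 2 * ∏ i, gaussDensity (y i - g i)) := by
  set R₁ := ∫⁻ y, ENNReal.ofReal ((t y - a) ^ 2 * ∏ i, gaussDensity (y i - f i)) with hR₁
  set R₂ := ∫⁻ y, ENNReal.ofReal ((t y + a) ^ 2 * ∏ i, gaussDensity (y i - g i)) with hR₂
  set ρ := a ^ 2 * Real.exp (-a ^ 2) with hρ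
  have hρ0 : 0 ≤ ρ := by positivity
  have hconst (c : ℝ) (hc : 0 ≤ c) (f : ι → ℝ) :
      ∫⁻ y : ι → ℝ, ENNReal.ofReal (c * ∏ i, gaussDensity (y i - f i)) = ENNReal.ofReal c := by
    simp_rw [ENNReal.ofReal_mul hc]
    rw [lintegral_const_mul _ (measurable_prod_gaussDensity f).ennreal_ofReal,
      lintegral_prod_gaussDensity, mul_one]
  have hmf := measurable_prod_gaussDensity f
  have hmg := measurable_prod_gaussDensity g
  have hpos (f y : ι → ℝ) : 0 ≤ ∏ i, gaussDensity (y i - f i) :=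
    Finset.prod_nonneg fun i _ => gaussDensity_nonneg _
  have key : ENNReal.ofReal (4 * ρ) ≤
      R₁ + R₂ + ENNReal.ofReal ρ + ENNReal.ofReal ρ := by
    rw [← hconst (4 * ρ) (by positivity) (fun i => (f i + g i) / 2)]
    nth_rewrite 2 [← hconst ρ hρ0 f]
    rw [← hconst ρ hρ0 g, hR₁, hR₂, ← lintegral_add_left (by fun_prop),
      ← lintegral_add_left (by fun_prop), ← lintegral_add_left (by fun_prop)]
    refine lintegral_mono fun y => ?_
    rw [← ENNReal.ofReal_add, ← ENNReal.ofReal_add, ← ENNReal.ofReal_add]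
    · refine ENNReal.ofReal_le_ofReal ?_
      have := two_point_pointwise (a := a) (t := t y) (hpos f y) (hpos g y)
        (Real.exp_pos (-a ^ 2)) (prod_gaussDensity_mul h y)
      rw [hρ]
      linarith
    all_goals
      have := hpos f y
      have := hpos g y
      positivity
  have e : ENNReal.ofReal (4 * ρ) =
      ENNReal.ofReal (2 * ρ) + (ENNReal.ofReal ρ + ENNReal.ofReal ρ) := by
    rw [← ENNReal.ofReal_add hρ0 hρ0, ← ENNReal.ofReal_add (by positivity) (by positivity)]
    ring_nf
  rw [e, add_assoc (R₁ + R₂)] at key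
  exact (ENNReal.add_le_add_iff_right (by simp)).mp key

/-- Assouad-type lower bound on the minimax risk, from the hypercube of signals whose
coefficients in the eigenbasis are `± δ` on `F` and vanish off `F`. -/
lemma le_graphMinimax {n : ℕ} (hn : 0 < n) {r β Q δ : ℝ} {U : Matrix (Fin n) (Fin n) ℝ}
    {ev : Fin n → ℝ} (hU : Uᵀ * U = 1) (F : Finset (Fin n))
    (hF : (∑ j ∈ F, (1 + ((n : ℝ) ^ (2 / r) * ev j) ^ β)) * δ ^ 2 ≤ n * Q ^ 2) :
    ENNReal.ofReal (F.card * (δ ^ 2 * Real.exp (-δ ^ 2)) / n) ≤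
      graphMinimax n r β Q U ev := by
  have hn' : (0 : ℝ) < n := by exact_mod_cast hn
  refine le_iInf₂ fun est hest => ?_
  set M := ⨆ f ∈ holderBall n r β Q U ev, graphRisk n est f with hM
  set ρ := δ ^ 2 * Real.exp (-δ ^ 2) with hρ
  have hρ0 : 0 ≤ ρ := by positivity
  let θ : (Fin n → Bool) → Fin n → ℝ := fun s j =>
    if j ∈ F then (if s j then δ else -δ) else 0
  have hθsq (s : Fin n → Bool) (j : Fin n) : θ s j ^ 2 = if j ∈ F then δ ^ 2 else 0 := by
    simp only [θ]; split_ifs <;> simp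
  let f : (Fin n → Bool) → Fin n → ℝ := fun s k => ∑ i, U k i * θ s i
  have hfθ (s : Fin n → Bool) (j : Fin n) : ∑ k, U k j * f s k = θ s j :=
    sum_mul_sum_of_transpose_mul_self hU _ _
  have hball (s : Fin n → Bool) : f s ∈ holderBall n r β Q U ev := by
    change 1 / (n : ℝ) * ∑ i, (1 + ((n : ℝ) ^ (2 / r) * ev i) ^ β) *
      (∑ k, U k i * f s k) ^ 2 ≤ Q ^ 2
    simp_rw [hfθ, hθsq, mul_ite, mul_zero]
    rw [Finset.sum_ite_mem, Finset.univ_inter, ← Finset.sum_mul, one_div, inv_mul_le_iff₀ hn']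
    exact hF
  let T : Fin n → (Fin n → ℝ) → ℝ := fun j y => ∑ k, U k j * est y k
  have hT (j : Fin n) : Measurable (T j) :=
    Finset.measurable_sum _ fun k _ => ((measurable_pi_apply k).comp hest).const_mul _
  let R : Fin n → (Fin n → Bool) → ℝ≥0∞ := fun j s =>
    ∫⁻ y, ENNReal.ofReal ((T j y - θ s j) ^ 2 * ∏ i, gaussDensity (y i - f s i))
  let flip : Fin n → (Fin n → Bool) → Fin n → Bool := fun j s => Function.update s j (!s j)
  have hflip (j : Fin n) : Function.Involutive (flip j) := fun s => by simp [flip]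
  have hpair (j : Fin n) (hj : j ∈ F) (s : Fin n → Bool) :
      ENNReal.ofReal (2 * ρ) ≤ R j s + R j (flip j s) := by
    have hneg : θ (flip j s) j = -θ s j := by
      simp only [θ, flip, hj, if_true, Function.update_self]
      cases s j <;> simp
    have hsq : θ s j ^ 2 = δ ^ 2 := by rw [hθsq, if_pos hj]
    have hdist : ∑ k, (f s k - f (flip j s) k) ^ 2 = 4 * θ s j ^ 2 := by
      rw [← sum_sq_transpose_mulVec hU]
      simp_rw [mul_sub, Finset.sum_sub_distrib, hfθ]
      rw [Finset.sum_eq_single j]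
      · rw [hneg]; ring
      · intro i _ hi
        simp [θ, flip, Function.update_of_ne hi]
      · simp
    have h := two_point_lower_bound hdist (hT j)
    rw [hsq, ← hρ] at h
    simpa only [R, hneg, sub_neg_eq_add] using h
  have hrisk (s : Fin n → Bool) : ∑ j ∈ F, R j s ≤ n * M := by
    have h1 : graphRisk n est (f s) ≤ M := le_iSup₂_of_le (f s) (hball s) le_rfl
    have h2 : ∑ j ∈ F, R j s ≤ ∫⁻ y, ENNReal.ofReal
        ((∑ i, (est y i - f s i) ^ 2) * ∏ i, gaussDensity (y i - f s i)) := by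
      have hm := measurable_prod_gaussDensity (f s)
      rw [← lintegral_finsetSum]
      · refine lintegral_mono fun y => ?_
        have hp : 0 ≤ ∏ i, gaussDensity (y i - f s i) :=
          Finset.prod_nonneg fun i _ => gaussDensity_nonneg _
        rw [← ENNReal.ofReal_sum_of_nonneg fun j _ => mul_nonneg (sq_nonneg _) hp,
          ← Finset.sum_mul]
        refine ENNReal.ofReal_le_ofReal (mul_le_mul_of_nonneg_right ?_ hp)
        rw [← sum_sq_transpose_mulVec hU]
        simp_rw [mul_sub, Finset.sum_sub_distrib, hfθ]
        exact Finset.sum_le_univ_sum_of_nonneg fun j => sq_nonneg _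
      · intro j _
        have := hT j
        fun_prop
    refine h2.trans ?_
    unfold graphRisk at h1
    rwa [ENNReal.inv_mul_le_iff (by exact_mod_cast hn.ne') (by simp)] at h1
  have havg : (Fintype.card (Fin n → Bool) : ℝ≥0∞) * (F.card * ENNReal.ofReal (2 * ρ)) ≤
      Fintype.card (Fin n → Bool) * (2 * (n * M)) := by
    calc (Fintype.card (Fin n → Bool) : ℝ≥0∞) * (F.card * ENNReal.ofReal (2 * ρ))
        = ∑ j ∈ F, ∑ _s : Fin n → Bool, ENNReal.ofReal (2 * ρ) := by
          simp only [Finset.sum_const, Finset.card_univ, nsmul_eq_mul]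
          ring
      _ ≤ ∑ j ∈ F, ∑ s, (R j s + R j (flip j s)) :=
          Finset.sum_le_sum fun j hj => Finset.sum_le_sum fun s _ => hpair j hj s
      _ = ∑ j ∈ F, 2 * ∑ s, R j s := by
          refine Finset.sum_congr rfl fun j _ => ?_
          rw [Finset.sum_add_distrib, two_mul]
          congr 1
          exact Equiv.sum_comp (hflip j).toPerm (R j)
      _ = 2 * ∑ s, ∑ j ∈ F, R j s := by rw [← Finset.mul_sum, Finset.sum_comm]
      _ ≤ 2 * ∑ _s : Fin n → Bool, n * M := by
          gcongr with s
          exact hrisk s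
      _ = Fintype.card (Fin n → Bool) * (2 * (n * M)) := by
          simp only [Finset.sum_const, Finset.card_univ, nsmul_eq_mul]
          ring
  rw [ENNReal.mul_le_mul_iff_right (by exact_mod_cast Fintype.card_ne_zero) (by simp),
    ENNReal.ofReal_mul two_pos.le, ENNReal.ofReal_ofNat, mul_left_comm,
    ENNReal.mul_le_mul_iff_right two_ne_zero ENNReal.ofNat_ne_top] at havg
  rw [ENNReal.ofReal_div_of_pos hn', ENNReal.ofReal_mul (Nat.cast_nonneg _),
    ENNReal.ofReal_natCast, ENNReal.ofReal_natCast]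
  exact ENNReal.div_le_of_le_mul' havg

lemma rpow_mul_geom_rpow {n x r β K : ℝ} (hn : 0 < n) (hx : 0 ≤ x) (hK : 0 ≤ K) :
    (n ^ (2 / r) * (K * (x / n) ^ (2 / r))) ^ β = K ^ β * x ^ (2 * β / r) := by
  have h : n ^ (2 / r) * (K * (x / n) ^ (2 / r)) = K * x ^ (2 / r) := by
    rw [mul_left_comm, ← Real.mul_rpow hn.le (by positivity), mul_div_cancel₀ _ hn.ne']
  rw [h, Real.mul_rpow hK (by positivity), ← Real.rpow_mul hx]
  ring_nf

/-- Kirichenko–van Zanten: for a sequence of connected graphs whose Laplacian eigenvalues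
satisfy the geometry condition with dimension `r`, the minimax rate of recovery of a
signal in the Hölder-type ball `B^β(Q)` over the graph is `n^{-2β/(2β+r)}`. -/
theorem statement18 (β Q r : ℝ) (hβ : 0 < β) (hQ : 0 < Q) (hr : 1 ≤ r)
    (A : ∀ n : ℕ, Matrix (Fin n) (Fin n) ℝ)
    (hAsym : ∀ n, (A n).IsSymm)
    (hA01 : ∀ n i j, A n i j = 0 ∨ A n i j = 1)
    (hAdiag : ∀ n i, A n i i = 0)
    (hconn : ∀ n, 1 ≤ n → (SimpleGraph.fromRel fun i j : Fin n => A n i j = 1).Connected)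
    (U : ∀ n : ℕ, Matrix (Fin n) (Fin n) ℝ) (ev : ∀ n : ℕ, Fin n → ℝ)
    (hdecomp : ∀ n, Matrix.diagonal (fun i => ∑ j, A n i j) - A n =
      U n * Matrix.diagonal (ev n) * (U n)ᵀ)
    (horth : ∀ n, (U n)ᵀ * U n = 1)
    (hmono : ∀ n, Monotone (ev n))
    (hzero : ∀ n (hn : 0 < n), ev n ⟨0, hn⟩ = 0)
    (i0 : ℕ) (C1 C2 : ℝ) (hC1 : 0 < C1) (hC2 : 0 < C2)
    (hgeom : ∀ n, ∀ i : Fin n, i0 ≤ (i : ℕ) →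
      C1 * ((i : ℝ) / n) ^ (2 / r) ≤ ev n i ∧ ev n i ≤ C2 * ((i : ℝ) / n) ^ (2 / r)) :
    ∃ c C : ℝ, 0 < c ∧ c ≤ C ∧ ∀ᶠ n : ℕ in atTop,
      ENNReal.ofReal (c * (n : ℝ) ^ (-(2 * β) / (2 * β + r))) ≤
        graphMinimax n r β Q (U n) (ev n) ∧
      graphMinimax n r β Q (U n) (ev n) ≤
        ENNReal.ofReal (C * (n : ℝ) ^ (-(2 * β) / (2 * β + r))) := by
  have hr0 : 0 < r := by linarith
  have hD0 : 0 < 2 * β + r := by linarith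
  set κ := r / (2 * β + r) with hκ
  have hκ0 : 0 < κ := by positivity
  have hexp : -(2 * β) / (2 * β + r) = κ - 1 := by rw [hκ]; field_simp; ring
  have hκβ : κ * (2 * β / r) = 1 - κ := by rw [hκ]; field_simp; ring
  have hκ1 : κ ≤ 1 := by rw [hκ, div_le_one hD0]; linarith
  have hb : 0 ≤ 2 * β / r := by positivity
  rw [hexp]
  set K := 1 + C2 ^ β with hK
  have hK0 : 0 < K := by positivity
  set δ := Q / Real.sqrt K with hδ
  have hδ2 : δ ^ 2 = Q ^ 2 / K := by rw [hδ, div_pow, Real.sq_sqrt hK0.le]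
  have hδ0 : 0 < δ := by positivity
  set ρ := δ ^ 2 * Real.exp (-δ ^ 2) with hρ
  have hρ0 : 0 < ρ := by positivity
  set D := C1 ^ β * (1 / 2) ^ (2 * β / r) with hD
  have hDpos : 0 < D := by positivity
  have hCpos : 0 < Q ^ 2 / D := by positivity
  refine ⟨ρ / 2, ρ / 2 + (1 + Q ^ 2 / D), by positivity, by linarith, ?_⟩
  have htend : Tendsto (fun n : ℕ => (n : ℝ) ^ κ) atTop atTop :=
    (tendsto_rpow_atTop hκ0).comp tendsto_natCast_atTop_atTop
  filter_upwards [eventually_gt_atTop i0, eventually_gt_atTop 0,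
    htend.eventually_ge_atTop ((i0 : ℝ) + 1)] with n hni hn hni'
  have hn' : (0 : ℝ) < n := by exact_mod_cast hn
  have hn1 : (1 : ℝ) ≤ n := by exact_mod_cast hn
  have hi00 : (0 : ℝ) ≤ i0 := Nat.cast_nonneg _
  set J := ⌊(n : ℝ) ^ κ⌋₊ with hJ
  have hJle : (J : ℝ) ≤ (n : ℝ) ^ κ := Nat.floor_le (by positivity)
  have hJlt : (n : ℝ) ^ κ < J + 1 := Nat.lt_floor_add_one _
  have hJi : i0 + 1 ≤ J := Nat.le_floor (by exact_mod_cast hni')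
  have hJ1 : (1 : ℝ) ≤ J := by exact_mod_cast (by omega : 1 ≤ J)
  have hJhalf : (n : ℝ) ^ κ * (1 / 2) ≤ J := by linarith
  have hJn : J ≤ n := by
    have h : (J : ℝ) ≤ n := hJle.trans (Real.rpow_le_self_of_one_le hn1 hκ1)
    exact_mod_cast h
  have hev (i : Fin n) : 0 ≤ ev n i := by
    rw [← hzero n hn]
    exact hmono n (Fin.mk_le_of_le_val (Nat.zero_le _))
  have hw (i : Fin n) : 0 ≤ (n : ℝ) ^ (2 / r) * ev n i :=
    mul_nonneg (by positivity) (hev i)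
  have hdiv : (n : ℝ) ^ κ / n = (n : ℝ) ^ (κ - 1) := by
    rw [Real.rpow_sub hn', Real.rpow_one]
  set F : Finset (Fin n) := Finset.univ.filter fun i => (i : ℕ) < J with hF
  have hcard : F.card = J := by
    rw [hF, Fin.card_filter_val_lt, min_eq_right hJn]
  have hpow : ((n : ℝ) ^ κ) ^ (2 * β / r) = (n : ℝ) ^ (1 - κ) := by
    rw [← Real.rpow_mul hn'.le, hκβ]
  constructor
  · have hweight : ∀ j ∈ F, 1 + ((n : ℝ) ^ (2 / r) * ev n j) ^ β ≤ K * (n : ℝ) ^ (1 - κ) := by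
      intro j hj
      have hjJ : (j : ℕ) < J := (Finset.mem_filter.mp hj).2
      let m : Fin n := ⟨max j i0, max_lt j.2 hni⟩
      have hmJ : ((m : ℕ) : ℝ) ≤ (n : ℝ) ^ κ := by
        refine le_trans ?_ hJle
        exact_mod_cast max_le hjJ.le (by omega)
      have h1 : ev n j ≤ C2 * (((m : ℕ) : ℝ) / n) ^ (2 / r) :=
        (hmono n (Fin.le_def.mpr (le_max_left _ _))).trans (hgeom n m (le_max_right _ _)).2
      have h2 : ((n : ℝ) ^ (2 / r) * ev n j) ^ β ≤ C2 ^ β * (n : ℝ) ^ (1 - κ) := by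
        calc ((n : ℝ) ^ (2 / r) * ev n j) ^ β
            ≤ ((n : ℝ) ^ (2 / r) * (C2 * (((m : ℕ) : ℝ) / n) ^ (2 / r))) ^ β :=
              Real.rpow_le_rpow (hw j) (by gcongr) hβ.le
          _ = C2 ^ β * ((m : ℕ) : ℝ) ^ (2 * β / r) :=
              rpow_mul_geom_rpow hn' (Nat.cast_nonneg _) hC2.le
          _ ≤ C2 ^ β * (n : ℝ) ^ (1 - κ) := by
              rw [← hpow]
              gcongr
      have h3 : 1 ≤ (n : ℝ) ^ (1 - κ) := Real.one_le_rpow hn1 (by linarith)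
      rw [hK]
      linarith
    have hbudget : (∑ j ∈ F, (1 + ((n : ℝ) ^ (2 / r) * ev n j) ^ β)) * δ ^ 2 ≤ n * Q ^ 2 := by
      calc (∑ j ∈ F, (1 + ((n : ℝ) ^ (2 / r) * ev n j) ^ β)) * δ ^ 2
          ≤ (J * (K * (n : ℝ) ^ (1 - κ))) * δ ^ 2 := by
            gcongr
            simpa [hcard] using Finset.sum_le_card_nsmul F _ _ hweight
        _ ≤ ((n : ℝ) ^ κ * (K * (n : ℝ) ^ (1 - κ))) * δ ^ 2 := by gcongr
        _ = ((n : ℝ) ^ κ * (n : ℝ) ^ (1 - κ)) * Q ^ 2 := by rw [hδ2]; field_simp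
        _ = n * Q ^ 2 := by rw [← Real.rpow_add hn', add_sub_cancel, Real.rpow_one]
    refine le_trans (ENNReal.ofReal_le_ofReal ?_) (le_graphMinimax hn (horth n) F hbudget)
    rw [hcard, ← hdiv, ← hρ]
    calc ρ / 2 * ((n : ℝ) ^ κ / n) = (n : ℝ) ^ κ * (1 / 2) * ρ / n := by ring
      _ ≤ J * ρ / n := by gcongr
  · have hB : 0 < D * (n : ℝ) ^ (1 - κ) := by positivity
    have hweight : ∀ j ∉ F,
        D * (n : ℝ) ^ (1 - κ) ≤ 1 + ((n : ℝ) ^ (2 / r) * ev n j) ^ β := by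
      intro j hj
      have hjJ : J ≤ (j : ℕ) := by simpa [hF] using hj
      have hjr : (n : ℝ) ^ κ * (1 / 2) ≤ ((j : ℕ) : ℝ) := hJhalf.trans (by exact_mod_cast hjJ)
      have h1 := (hgeom n j (by omega)).1
      calc D * (n : ℝ) ^ (1 - κ)
          = C1 ^ β * ((n : ℝ) ^ κ * (1 / 2)) ^ (2 * β / r) := by
            rw [Real.mul_rpow (by positivity) (by positivity), hpow, hD]; ring
        _ ≤ C1 ^ β * ((j : ℕ) : ℝ) ^ (2 * β / r) := by gcongr
        _ = ((n : ℝ) ^ (2 / r) * (C1 * (((j : ℕ) : ℝ) / n) ^ (2 / r))) ^ β :=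
            (rpow_mul_geom_rpow hn' (Nat.cast_nonneg _) hC1.le).symm
        _ ≤ ((n : ℝ) ^ (2 / r) * ev n j) ^ β :=
            Real.rpow_le_rpow (by positivity) (by gcongr) hβ.le
        _ ≤ 1 + ((n : ℝ) ^ (2 / r) * ev n j) ^ β := by linarith
    refine (graphMinimax_le hn (horth n) hev F hB hweight).trans (ENNReal.ofReal_le_ofReal ?_)
    have hinv : Q ^ 2 / (D * (n : ℝ) ^ (1 - κ)) = Q ^ 2 / D * (n : ℝ) ^ (κ - 1) := by
      rw [← neg_sub 1 κ, Real.rpow_neg hn'.le]; field_simp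
    have hJdiv : (J : ℝ) / n ≤ (n : ℝ) ^ (κ - 1) := by rw [← hdiv]; gcongr
    have hpos : 0 ≤ ρ / 2 * (n : ℝ) ^ (κ - 1) := by positivity
    rw [hcard, hinv]
    linarith
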